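/- arXiv:1311.1568 — 4 statements merged into one kernel-verified Lean document; each statement's English description precedes it below -/
import Mathlib

section
/- (Pathwise geometric decay at return times.) Fix any (deterministic) delay sequence τ : ℕ → ℕ ∪ {∞} with induced buffer-length sequence λ, and consider the closed-loop trajectory with initial state χ ∈ ℝⁿ. If the i-th return time k_i to the empty-buffer state is finite (i ∈ ℕ, k_0 = 0), then V(x(k_i)) ≤ α^i · ρ^{k_i − i} · V(χ). (This is the pathwise content of the bound E{V(x(k_i))} ≤ (αΩ)^i V(χ) in the proof of Theorem 1: each return cycle of length Δ contributes a factor α·ρ^{Δ−1}.) -/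
open MeasureTheory ProbabilityTheory Filter
open scoped Classical

noncomputable section

/-- The set of transmission times whose packets have arrived by time `k`:
`A(k) = {ℓ ∈ ℕ : ℓ + τ(ℓ) ≤ k}` (inequality in `ℕ ∪ {∞}`). -/
def arrivalSet (τ : ℕ → ℕ∞) (k : ℕ) : Set ℕ :=
  {ℓ : ℕ | (ℓ : ℕ∞) + τ ℓ ≤ (k : ℕ∞)}

/-- The buffer-length sequence `λ` induced by the delay sequence `τ`:
`λ(0) = 0` and, for `k ≥ 1`, `λ(k) = max (0, T(k) + N - k)` if `A(k) ≠ ∅` (where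
`T(k) = max A(k)`, realized by `sSup`, and the truncated `ℕ`-subtraction realizes
`max (0, ·)`), and `λ(k) = 0` otherwise. -/
def bufLen (N : ℕ) (τ : ℕ → ℕ∞) (k : ℕ) : ℕ :=
  if k = 0 then 0
  else if (arrivalSet τ k).Nonempty then sSup (arrivalSet τ k) + N - k
  else 0

/-- The return times of the buffer-length sequence to `0`:
`k_0 = 0` and `k_{i+1} = inf {k ∈ ℕ : k > k_i, λ(k) = 0} ∈ ℕ ∪ {∞}` (`inf ∅ = ∞`). -/
def retTime (N : ℕ) (τ : ℕ → ℕ∞) : ℕ → ℕ∞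
  | 0 => 0
  | (i+1) => sInf {t : ℕ∞ | ∃ k : ℕ, t = (k : ℕ∞) ∧
      retTime N τ i < (k : ℕ∞) ∧ bufLen N τ k = 0}

/-- The disturbance-free networked closed-loop trajectory: `x(0) = χ` and
`x(k+1) = f (x(k)) (κ (x(k)))` if `λ(k) > 0`, `x(k+1) = f (x(k)) 0` if `λ(k) = 0`. -/
def traj {X U : Type*} [Zero U] (f : X → U → X) (κ : X → U)
    (lamseq : ℕ → ℕ) (χ : X) : ℕ → X
  | 0 => χ
  | (k+1) => if 0 < lamseq k then f (traj f κ lamseq χ k) (κ (traj f κ lamseq χ k))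
             else f (traj f κ lamseq χ k) 0

theorem retTime_succ_eq_coe {N : ℕ} {τ : ℕ → ℕ∞} {i b : ℕ} (h : retTime N τ (i + 1) = b) :
    ∃ a : ℕ, retTime N τ i = a ∧ a < b ∧ bufLen N τ b = 0 ∧
      ∀ k, a < k → k < b → 0 < bufLen N τ k := by
  have hne : {t : ℕ∞ | ∃ k : ℕ, t = (k : ℕ∞) ∧
      retTime N τ i < (k : ℕ∞) ∧ bufLen N τ k = 0}.Nonempty := by
    by_contra hemp
    rw [Set.not_nonempty_iff_eq_empty] at hemp
    rw [retTime, hemp, sInf_empty] at h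
    exact ENat.natCast_ne_top b h.symm
  obtain ⟨k, hk, hlt, hbuf⟩ := csInf_mem hne
  change retTime N τ (i + 1) = k at hk
  obtain rfl : b = k := by exact_mod_cast h.symm.trans hk
  obtain ⟨a, ha⟩ := ENat.ne_top_iff_exists.mp hlt.ne_top
  rw [← ha, Nat.cast_lt] at hlt
  refine ⟨a, ha.symm, hlt, hbuf, fun k hak hkb => ?_⟩
  by_contra hzero
  have hle : retTime N τ (i + 1) ≤ k :=
    sInf_le ⟨k, rfl, by rw [← ha]; exact_mod_cast hak, by omega⟩
  rw [h, Nat.cast_le] at hle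
  omega

theorem bufLen_eq_zero_of_retTime_eq_coe {N : ℕ} {τ : ℕ → ℕ∞} {i a : ℕ}
    (h : retTime N τ i = a) : bufLen N τ a = 0 := by
  cases i with
  | zero =>
    obtain rfl : a = 0 := by
      rw [retTime] at h
      exact_mod_cast h.symm
    simp [bufLen]
  | succ i =>
    obtain ⟨-, -, -, hb, -⟩ := retTime_succ_eq_coe h
    exact hb

theorem le_of_retTime_eq_coe {N : ℕ} {τ : ℕ → ℕ∞} {i a : ℕ}
    (h : retTime N τ i = a) : i ≤ a := by
  induction i generalizing a with
  | zero => exact a.zero_le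
  | succ i ih =>
    obtain ⟨c, hc, hca, -⟩ := retTime_succ_eq_coe h
    exact (ih hc).trans_lt hca

/-- One cycle: an open-loop step followed by `j` steps with a nonempty buffer. -/
theorem traj_cycle_le {X U : Type*} [Zero U] {f : X → U → X} {κ : X → U} {V : X → ℝ}
    {ρ α : ℝ} (hρ0 : 0 ≤ ρ) (hcontr : ∀ x, V (f x (κ x)) ≤ ρ * V x)
    (hopen : ∀ x, V (f x 0) ≤ α * V x) {lamseq : ℕ → ℕ} (χ : X) {a : ℕ}
    (ha : lamseq a = 0) (j : ℕ) (hpos : ∀ k, a < k → k < a + 1 + j → 0 < lamseq k) :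
    V (traj f κ lamseq χ (a + 1 + j)) ≤ ρ ^ j * (α * V (traj f κ lamseq χ a)) := by
  induction j with
  | zero => simpa [traj, ha] using hopen (traj f κ lamseq χ a)
  | succ j ih =>
    rw [← add_assoc, traj, if_pos (hpos _ (by omega) (by omega)), pow_succ', mul_assoc]
    exact (hcontr _).trans
      (mul_le_mul_of_nonneg_left (ih fun k h₁ h₂ => hpos k h₁ (by omega)) hρ0)

/-- **Pathwise geometric decay at return times**: for any deterministic delay
sequence `τ`, if the `i`-th return time `k_i` to the empty-buffer state is finite,
then `V(x(k_i)) ≤ α^i · ρ^{k_i - i} · V(χ)`. -/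
theorem pathwise_decay_at_return_times
    (N : ℕ) (hN : 1 ≤ N) (τ : ℕ → ℕ∞)
    {n m : ℕ} (f : (Fin n → ℝ) → (Fin m → ℝ) → (Fin n → ℝ))
    (κ : (Fin n → ℝ) → (Fin m → ℝ)) (V : (Fin n → ℝ) → ℝ) (hV0 : ∀ x, 0 ≤ V x)
    (ρ : ℝ) (hρ0 : 0 ≤ ρ) (hρ1 : ρ < 1)
    (hcontr : ∀ x, V (f x (κ x)) ≤ ρ * V x)
    (α : ℝ) (hα : 0 ≤ α) (hopen : ∀ x, V (f x 0) ≤ α * V x)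
    (χ : Fin n → ℝ) (i : ℕ) (hfin : retTime N τ i ≠ ⊤) :
    V (traj f κ (bufLen N τ) χ ((retTime N τ i).toNat))
      ≤ α ^ i * ρ ^ ((retTime N τ i).toNat - i) * V χ := by
  obtain ⟨a, ha⟩ := ENat.ne_top_iff_exists.mp hfin
  rw [← ha, ENat.toNat_natCast]
  replace ha := ha.symm
  clear hfin
  induction i generalizing a with
  | zero =>
    obtain rfl : a = 0 := by
      rw [retTime] at ha
      exact_mod_cast ha.symm
    simp [traj]
  | succ i ih =>
    obtain ⟨c, hc, hca, -, hpos⟩ := retTime_succ_eq_coe ha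
    have hic := le_of_retTime_eq_coe hc
    obtain ⟨j, rfl⟩ := Nat.exists_eq_add_of_le (Nat.succ_le_of_lt hca)
    calc V (traj f κ (bufLen N τ) χ (c + 1 + j))
        ≤ ρ ^ j * (α * V (traj f κ (bufLen N τ) χ c)) :=
          traj_cycle_le hρ0 hcontr hopen χ (bufLen_eq_zero_of_retTime_eq_coe hc) j hpos
      _ ≤ ρ ^ j * (α * (α ^ i * ρ ^ (c - i) * V χ)) := by
          gcongr
          exact ih c hc
      _ = α ^ (i + 1) * ρ ^ (c + 1 + j - (i + 1)) * V χ := by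
          rw [show c + 1 + j - (i + 1) = j + (c - i) by omega]
          ring

end
end

section
/- (Pathwise per-cycle sum bound.) Fix any (deterministic) delay sequence τ : ℕ → ℕ ∪ {∞} with induced buffer-length sequence λ (so λ(0) = 0), and consider the closed-loop trajectory with initial state χ ∈ ℝⁿ. Let K = inf{k ≥ 1 : λ(k) = 0} ∈ ℕ ∪ {∞} be the first return time to the empty-buffer state. Then Σ_{k=0}^{K−1} V(x(k)) ≤ ((1 + α − ρ)/(1 − ρ)) · V(χ), where the sum is over all k ∈ ℕ when K = ∞. (This is the per-cycle bound used in the proof of Theorem 1.) -/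
open MeasureTheory ProbabilityTheory Filter
open scoped Classical

noncomputable section

/-- Partial sums of a nonnegative sequence that contracts by the factor `ρ` from index `1` on. -/
theorem sum_range_le_of_eventual_contraction {a : ℕ → ℝ} {ρ α c : ℝ} (hρ1 : ρ < 1)
    (ha : ∀ k, 0 ≤ a k) (h0 : a 0 ≤ c) (h1 : a 1 ≤ α * c)
    (hstep : ∀ k, a (k + 2) ≤ ρ * a (k + 1)) (M : ℕ) :
    ∑ k ∈ Finset.range M, a k ≤ (1 + α - ρ) / (1 - ρ) * c := by
  have hpos : 0 < 1 - ρ := sub_pos.mpr hρ1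
  have tail (M : ℕ) :
      (1 - ρ) * ∑ k ∈ Finset.range M, a (k + 1) + a (M + 1) ≤ a 1 := by
    induction M with
    | zero => simp
    | succ M ih =>
      rw [Finset.sum_range_succ]
      linarith [hstep M]
  have hsucc : ∑ k ∈ Finset.range M, a k ≤ ∑ k ∈ Finset.range (M + 1), a k := by
    rw [Finset.sum_range_succ]
    linarith [ha M]
  refine hsucc.trans ?_
  rw [Finset.sum_range_succ', div_mul_eq_mul_div, le_div_iff₀ hpos]
  nlinarith [tail M, ha (M + 1), mul_le_mul_of_nonneg_left h0 hpos.le]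

/-- **Pathwise per-cycle sum bound**: for any deterministic delay sequence `τ` with
first return time `K = inf {k ≥ 1 : λ(k) = 0} ∈ ℕ ∪ {∞}` to the empty-buffer state,
`∑_{k=0}^{K-1} V(x(k)) ≤ ((1 + α - ρ)/(1 - ρ))·V(χ)` (every partial sum of the
nonnegative series over `{k : k < K}` is bounded, which for `K = ∞` is the sum over
all of `ℕ`). -/
theorem pathwise_cycle_sum_bound
    (N : ℕ) (hN : 1 ≤ N) (τ : ℕ → ℕ∞)
    {n m : ℕ} (f : (Fin n → ℝ) → (Fin m → ℝ) → (Fin n → ℝ))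
    (κ : (Fin n → ℝ) → (Fin m → ℝ)) (V : (Fin n → ℝ) → ℝ) (hV0 : ∀ x, 0 ≤ V x)
    (ρ : ℝ) (hρ0 : 0 ≤ ρ) (hρ1 : ρ < 1)
    (hcontr : ∀ x, V (f x (κ x)) ≤ ρ * V x)
    (α : ℝ) (hα : 0 ≤ α) (hopen : ∀ x, V (f x 0) ≤ α * V x)
    (χ : Fin n → ℝ) :
    ∀ M : ℕ, ∑ k ∈ Finset.range M,
        (if (k : ℕ∞) < sInf {t : ℕ∞ | ∃ k' : ℕ, t = (k' : ℕ∞) ∧ 1 ≤ k' ∧ bufLen N τ k' = 0}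
         then V (traj f κ (bufLen N τ) χ k) else 0)
      ≤ (1 + α - ρ) / (1 - ρ) * V χ := by
  set K := sInf {t : ℕ∞ | ∃ k' : ℕ, t = (k' : ℕ∞) ∧ 1 ≤ k' ∧ bufLen N τ k' = 0} with hK
  have hbuf (k : ℕ) (hk : ((k + 1 : ℕ) : ℕ∞) < K) : 0 < bufLen N τ (k + 1) := by
    by_contra hzero
    exact hk.not_ge (sInf_le ⟨k + 1, rfl, by omega, by omega⟩)
  refine sum_range_le_of_eventual_contraction hρ1 (fun k => ?_) ?_ ?_ (fun k => ?_)
  · split_ifs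
    exacts [hV0 _, le_rfl]
  · split_ifs
    exacts [le_rfl, hV0 χ]
  · split_ifs
    · simpa [traj, bufLen] using hopen χ
    · exact mul_nonneg hα (hV0 χ)
  · by_cases hk : ((k + 2 : ℕ) : ℕ∞) < K
    · have hk' : ((k + 1 : ℕ) : ℕ∞) < K :=
        lt_trans (Nat.cast_lt.mpr (Nat.lt_succ_self _)) hk
      rw [if_pos hk, if_pos hk', traj, if_pos (hbuf k hk')]
      exact hcontr _
    · rw [if_neg hk]
      refine mul_nonneg hρ0 ?_
      split_ifs
      exacts [hV0 _, le_rfl]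

end
end

section
/- For every delay sequence τ : ℕ → ℕ ∪ {∞}, every k ≥ 1 and every ℓ ∈ {0,1,…,N−1} with ℓ ≤ k, the induced buffer-length sequence satisfies: λ(k) = N − ℓ if and only if τ(k − ℓ) ≤ ℓ and τ(k − ℓ + i) > ℓ − i for all i ∈ {1, …, ℓ}. (This is the pathwise characterization of a positive buffer length used in the proof of Lemma 1.) -/
open MeasureTheory ProbabilityTheory Filter
open scoped Classical

noncomputable section

theorem le_of_mem_arrivalSet {τ : ℕ → ℕ∞} {k j : ℕ} (h : j ∈ arrivalSet τ k) : j ≤ k := by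
  have h' : (j : ℕ∞) ≤ k := le_self_add.trans h
  exact_mod_cast h'

theorem bddAbove_arrivalSet (τ : ℕ → ℕ∞) (k : ℕ) : BddAbove (arrivalSet τ k) :=
  ⟨k, fun _ h => le_of_mem_arrivalSet h⟩

theorem add_mem_arrivalSet_iff (τ : ℕ → ℕ∞) (j d : ℕ) :
    j ∈ arrivalSet τ (j + d) ↔ τ j ≤ d := by
  simp only [arrivalSet, Set.mem_ofPred_eq, Nat.cast_add]
  exact ENat.add_le_add_iff_left (ENat.natCast_ne_top j)

theorem mem_arrivalSet_iff {τ : ℕ → ℕ∞} {k j : ℕ} (h : j ≤ k) :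
    j ∈ arrivalSet τ k ↔ τ j ≤ (k - j : ℕ) := by
  rw [← add_mem_arrivalSet_iff, Nat.add_sub_cancel' h]

theorem bufLen_eq_iff_isGreatest {N k ℓ : ℕ} (τ : ℕ → ℕ∞) (hk : 1 ≤ k) (hℓ : ℓ < N)
    (hℓk : ℓ ≤ k) : bufLen N τ k = N - ℓ ↔ IsGreatest (arrivalSet τ k) (k - ℓ) := by
  rw [bufLen, if_neg (by omega)]
  constructor
  · intro h
    split_ifs at h with hne
    · have hmem := Nat.sSup_mem hne (bddAbove_arrivalSet τ k)
      have heq : sSup (arrivalSet τ k) = k - ℓ := by omega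
      rw [← heq]
      exact ⟨hmem, fun _ hj => le_csSup (bddAbove_arrivalSet τ k) hj⟩
    · omega
  · intro h
    rw [if_pos h.nonempty, h.csSup_eq]
    omega

theorem isGreatest_arrivalSet_iff {k ℓ : ℕ} (τ : ℕ → ℕ∞) (hℓk : ℓ ≤ k) :
    IsGreatest (arrivalSet τ k) (k - ℓ) ↔
      (τ (k - ℓ) ≤ (ℓ : ℕ∞) ∧
        ∀ i, 1 ≤ i → i ≤ ℓ → ((ℓ - i : ℕ) : ℕ∞) < τ (k - ℓ + i)) := by
  have hmem : ∀ i ≤ ℓ, k - ℓ + i ∈ arrivalSet τ k ↔ τ (k - ℓ + i) ≤ (ℓ - i : ℕ) := by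
    intro i hi
    rw [mem_arrivalSet_iff (by omega), show k - (k - ℓ + i) = ℓ - i by omega]
  refine and_congr (hmem 0 ℓ.zero_le) ⟨fun h i hi hiℓ => ?_, fun h j hj => ?_⟩
  · by_contra hlt
    have := h ((hmem i hiℓ).2 (not_lt.1 hlt))
    omega
  · by_contra! hlt
    have hjk := le_of_mem_arrivalSet hj
    obtain ⟨i, rfl⟩ := Nat.exists_eq_add_of_le hlt.le
    exact (h i (by omega) (by omega)).not_ge ((hmem i (by omega)).1 hj)

/-- **Pathwise characterization of a positive buffer length**: for every delay
sequence `τ`, every `k ≥ 1` and every `ℓ ∈ {0,…,N-1}` with `ℓ ≤ k`, one has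
`λ(k) = N - ℓ` iff `τ(k-ℓ) ≤ ℓ` and `τ(k-ℓ+i) > ℓ-i` for all `i ∈ {1,…,ℓ}`. -/
theorem bufLen_positive_characterization
    (N : ℕ) (hN : 1 ≤ N) (τ : ℕ → ℕ∞) (k : ℕ) (hk : 1 ≤ k)
    (ℓ : ℕ) (hℓ : ℓ ≤ N - 1) (hℓk : ℓ ≤ k) :
    bufLen N τ k = N - ℓ ↔
      (τ (k - ℓ) ≤ (ℓ : ℕ∞) ∧
        ∀ i, 1 ≤ i → i ≤ ℓ → ((ℓ - i : ℕ) : ℕ∞) < τ (k - ℓ + i)) :=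
  (bufLen_eq_iff_isGreatest τ hk (by omega) hℓk).trans (isGreatest_arrivalSet_iff τ hℓk)

end
end

section
/- For the example system, the open-loop (zero-input) growth rate is bounded by the golden ratio: for every x = (x₁, x₂) ∈ ℝ², V(f(x, (0,0))) ≤ ((1 + √5)/2)·V(x); equivalently, ‖(x₂, −sat(x₁ + x₂))‖ ≤ ((1 + √5)/2)·‖x‖ (the paper's constant α = 1.618). -/
open MeasureTheory ProbabilityTheory Filter
open scoped Classical

noncomputable section

/-- The saturation function: `sat(μ) = -1` for `μ < -1`, `sat(μ) = μ` for `μ ∈ [-1,1]`,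
`sat(μ) = 1` for `μ > 1`. -/
def sat (μ : ℝ) : ℝ := max (-1) (min 1 μ)

/-- The example plant `f((x₁,x₂),(u₁,u₂)) = (x₂ + u₁, -sat(x₁+x₂) + u₂)` on `ℝ²`. -/
def fEx (x u : ℝ × ℝ) : ℝ × ℝ := (x.2 + u.1, -sat (x.1 + x.2) + u.2)

/-- The Lyapunov function `V(x) = 2‖x‖`, with `‖·‖` the Euclidean norm on `ℝ²`. -/
def VEx (x : ℝ × ℝ) : ℝ := 2 * Real.sqrt (x.1 ^ 2 + x.2 ^ 2)

theorem sat_sq_le (μ : ℝ) : sat μ ^ 2 ≤ μ ^ 2 := by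
  unfold sat
  rcases le_total 1 μ with h | h
  · rw [min_eq_left h, max_eq_right (by norm_num)]
    nlinarith
  · rw [min_eq_right h]
    rcases le_total (-1) μ with h' | h'
    · rw [max_eq_right h']
    · rw [max_eq_left h']
      nlinarith

/-- The linear map `(a, b) ↦ (b, a + b)` has operator norm at most the golden ratio. -/
theorem sq_add_add_sq_le_goldenRatio (a b : ℝ) :
    b ^ 2 + (a + b) ^ 2 ≤ Real.goldenRatio ^ 2 * (a ^ 2 + b ^ 2) := by
  have hφ := Real.goldenRatio_sq
  have key : Real.goldenRatio ^ 2 * (a ^ 2 + b ^ 2) - (b ^ 2 + (a + b) ^ 2)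
      = Real.goldenRatio * (a - (Real.goldenRatio - 1) * b) ^ 2 := by
    linear_combination (a ^ 2 + b ^ 2 + 2 * a * b - (Real.goldenRatio - 1) * b ^ 2) * hφ
  have := mul_nonneg Real.goldenRatio_pos.le (sq_nonneg (a - (Real.goldenRatio - 1) * b))
  linarith

/-- **Open-loop growth bound for the example system**:
`V(f(x, 0)) ≤ ((1 + √5)/2)·V(x)`; equivalently
`‖(x₂, -sat(x₁+x₂))‖ ≤ ((1 + √5)/2)·‖x‖` (the paper's constant `α = 1.618`). -/
theorem example_open_loop_growth (x : ℝ × ℝ) :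
    VEx (fEx x (0, 0)) ≤ ((1 + Real.sqrt 5) / 2) * VEx x := by
  change VEx (fEx x (0, 0)) ≤ Real.goldenRatio * VEx x
  have hsqrt : Real.sqrt (x.2 ^ 2 + (-sat (x.1 + x.2)) ^ 2)
      ≤ Real.goldenRatio * Real.sqrt (x.1 ^ 2 + x.2 ^ 2) := by
    rw [← Real.sqrt_sq Real.goldenRatio_pos.le, ← Real.sqrt_mul (sq_nonneg _)]
    apply Real.sqrt_le_sqrt
    have := sat_sq_le (x.1 + x.2)
    have := sq_add_add_sq_le_goldenRatio x.1 x.2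
    rw [neg_sq]
    linarith
  simp only [VEx, fEx, add_zero]
  linarith

end
end
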